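/- arXiv:2605.06034 — 2 statements merged into one kernel-verified Lean document; each statement's English description precedes it below -/
import Mathlib

section
/- The series ∑_{i=1}^∞ (H_i/(2i+1)²)·(∑_{k=1}^i h_k/k) converges and equals (31/16)·ζ(5) - (15/16)·ln(2)·ζ(4). -/
open Finset Real

noncomputable def H (k : ℕ) : ℝ := ∑ j ∈ Finset.range k, (1 : ℝ) / ((j : ℝ) + 1)
noncomputable def H2 (k : ℕ) : ℝ := ∑ j ∈ Finset.range k, (1 : ℝ) / ((j : ℝ) + 1) ^ 2
noncomputable def H3 (k : ℕ) : ℝ := ∑ j ∈ Finset.range k, (1 : ℝ) / ((j : ℝ) + 1) ^ 3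
noncomputable def h (k : ℕ) : ℝ := ∑ j ∈ Finset.range k, (1 : ℝ) / (2 * (j : ℝ) + 1)
noncomputable def h2 (k : ℕ) : ℝ := ∑ j ∈ Finset.range k, (1 : ℝ) / (2 * (j : ℝ) + 1) ^ 2
noncomputable def h3 (k : ℕ) : ℝ := ∑ j ∈ Finset.range k, (1 : ℝ) / (2 * (j : ℝ) + 1) ^ 3
noncomputable def zeta (s : ℕ) : ℝ := ∑' n : ℕ, (1 : ℝ) / ((n : ℝ) + 1) ^ s

open MeasureTheory Filter Topology

theorem hasSum_setIntegral_of_nonneg {F : ℕ → ℝ → ℝ} {f : ℝ → ℝ} {s : Set ℝ}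
    (hs : MeasurableSet s) (hF : ∀ n, Continuous (F n)) (hpos : ∀ n, ∀ t ∈ s, 0 ≤ F n t)
    (hsum : ∀ t ∈ s, HasSum (fun n => F n t) (f t)) (hf : IntegrableOn f s) :
    HasSum (fun n => ∫ t in s, F n t) (∫ t in s, f t) := by
  refine hasSum_integral_of_dominated_convergence F
    (fun n => (hF n).aestronglyMeasurable) (fun n => ?_) ?_ ?_ ?_
  · filter_upwards [ae_restrict_mem hs] with t ht
    rw [Real.norm_of_nonneg (hpos n t ht)]
  · filter_upwards [ae_restrict_mem hs] with t ht using (hsum t ht).summable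
  · refine hf.congr ?_
    filter_upwards [ae_restrict_mem hs] with t ht using (hsum t ht).tsum_eq.symm
  · filter_upwards [ae_restrict_mem hs] with t ht using hsum t ht

theorem hasDerivAt_tanh (t : ℝ) : HasDerivAt tanh (1 / cosh t ^ 2) t := by
  have hd := (hasDerivAt_sinh t).div (hasDerivAt_cosh t) (cosh_pos t).ne'
  refine (hd.congr_deriv ?_).congr_of_eventuallyEq (.of_forall fun x => tanh_eq_sinh_div_cosh x)
  rw [← cosh_sq_sub_sinh_sq t]
  ring

theorem continuous_tanh : Continuous tanh :=
  continuous_iff_continuousAt.2 fun t => (hasDerivAt_tanh t).continuousAt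

theorem one_sub_tanh_sq (t : ℝ) : 1 - tanh t ^ 2 = 1 / cosh t ^ 2 := by
  have hc := (cosh_pos t).ne'
  rw [tanh_eq_sinh_div_cosh]
  field_simp
  linarith [cosh_sq_sub_sinh_sq t]

theorem tanh_nonneg {t : ℝ} (ht : 0 ≤ t) : 0 ≤ tanh t := by
  rw [tanh_eq_sinh_div_cosh]
  exact div_nonneg (sinh_nonneg_iff.2 ht) (cosh_pos t).le

theorem one_sub_tanh (t : ℝ) : 1 - tanh t = exp (-t) / cosh t := by
  have hc := (cosh_pos t).ne'
  rw [tanh_eq_sinh_div_cosh, ← cosh_sub_sinh]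
  field_simp

theorem tendsto_mul_one_sub_tanh : Tendsto (fun t => t * (1 - tanh t)) atTop (𝓝 0) := by
  have he : Tendsto (fun t : ℝ => t * exp (-t)) atTop (𝓝 0) := by
    simpa using tendsto_pow_mul_exp_neg_atTop_nhds_zero 1
  refine tendsto_of_tendsto_of_tendsto_of_le_of_le' tendsto_const_nhds he ?_ ?_
  · filter_upwards [eventually_ge_atTop 0] with t ht
    exact mul_nonneg ht (sub_nonneg.2 (tanh_lt_one t).le)
  · filter_upwards [eventually_ge_atTop 0] with t ht
    rw [one_sub_tanh]
    exact mul_le_mul_of_nonneg_left (div_le_self (exp_pos _).le (one_le_cosh t)) ht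

theorem tendsto_tanh_atTop : Tendsto tanh atTop (𝓝 1) := by
  have he : Tendsto (fun t : ℝ => t⁻¹ * (t * (1 - tanh t))) atTop (𝓝 (0 * 0)) :=
    tendsto_inv_atTop_zero.mul tendsto_mul_one_sub_tanh
  have hl : Tendsto (fun t : ℝ => 1 - t⁻¹ * (t * (1 - tanh t))) atTop (𝓝 (1 - 0 * 0)) :=
    he.const_sub 1
  rw [mul_zero, sub_zero] at hl
  refine hl.congr' ?_
  filter_upwards [eventually_gt_atTop 0] with t ht
  field_simp
  ring

theorem tendsto_sub_log_cosh : Tendsto (fun t => t - log (cosh t)) atTop (𝓝 (log 2)) := by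
  have he : Tendsto (fun t : ℝ => (1 + exp (-(2 * t))) / 2) atTop (𝓝 ((1 + 0) / 2)) :=
    ((tendsto_exp_neg_atTop_nhds_zero.comp
      (tendsto_id.const_mul_atTop (two_pos (α := ℝ)))).const_add 1).div_const 2
  have hl := (he.log (by norm_num)).neg
  rw [show -log ((1 + 0) / 2) = log 2 by rw [← log_inv]; norm_num] at hl
  refine hl.congr fun t => ?_
  have hc : (1 + exp (-(2 * t))) / 2 = exp (-t) * cosh t := by
    rw [cosh_eq, mul_div_assoc', mul_add, ← exp_add, ← exp_add]
    ring_nf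
    simp [add_comm]
  rw [hc, log_mul (exp_pos _).ne' (cosh_pos t).ne', log_exp]
  ring

theorem hasDerivAt_tanh_pow_div (i : ℕ) (t : ℝ) :
    HasDerivAt (fun t => tanh t ^ (2 * i + 1) / (2 * i + 1)) (tanh t ^ (2 * i) / cosh t ^ 2) t := by
  refine (((hasDerivAt_tanh t).pow (2 * i + 1)).div_const (2 * i + 1 : ℝ)).congr_deriv ?_
  have hi : (2 * i + 1 : ℝ) ≠ 0 := by positivity
  push_cast
  field_simp

theorem continuous_tanh_pow_div (i : ℕ) :
    Continuous fun t : ℝ => tanh t ^ (2 * i) / cosh t ^ 2 :=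
  (continuous_tanh.pow _).div₀ (continuous_cosh.pow 2) fun t => (pow_pos (cosh_pos t) 2).ne'

theorem integral_tanh_pow (i : ℕ) :
    ∫ t in Set.Ioi (0 : ℝ), tanh t ^ (2 * i) / cosh t ^ 2 = 1 / (2 * i + 1) := by
  rw [integral_Ioi_of_hasDerivAt_of_nonneg' (fun t _ => hasDerivAt_tanh_pow_div i t)
    (fun t ht => by have := tanh_nonneg (le_of_lt ht); positivity)
    ((tendsto_tanh_atTop.pow _).div_const _)]
  simp

theorem exists_primitive_mul_tanh_pow (i : ℕ) : ∃ G : ℝ → ℝ, G 0 = 0 ∧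
    (∀ t, HasDerivAt G (t * (tanh t ^ (2 * i) / cosh t ^ 2)) t) ∧
    Tendsto G atTop (𝓝 ((H i + 2 * log 2) / (2 * (2 * i + 1)))) := by
  induction i with
  | zero =>
    refine ⟨fun t => t * tanh t - log (cosh t), by simp, fun t => ?_, ?_⟩
    · refine (((hasDerivAt_id t).mul (hasDerivAt_tanh t)).sub
        ((hasDerivAt_cosh t).log (cosh_pos t).ne')).congr_deriv ?_
      rw [tanh_eq_sinh_div_cosh]
      simp
    · have hl := tendsto_sub_log_cosh.sub tendsto_mul_one_sub_tanh
      rw [show log 2 - 0 = (H 0 + 2 * log 2) / (2 * (2 * (0 : ℕ) + 1)) by simp [H]] at hl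
      exact hl.congr fun t => by ring
  | succ i ih =>
    obtain ⟨G, G0, hG, hlim⟩ := ih
    have hi : (2 * (i + 1) + 1 : ℝ) ≠ 0 := by positivity
    have hi' : (2 * i + 1 : ℝ) ≠ 0 := by positivity
    have hi'' : (i + 1 : ℝ) ≠ 0 := by positivity
    refine ⟨fun t => ((2 * i + 1) * G t + t * (tanh t ^ (2 * i + 3) - tanh t ^ (2 * i + 1))
      + tanh t ^ (2 * i + 2) / (2 * i + 2)) / (2 * (i + 1) + 1), by simp [G0], fun t => ?_, ?_⟩
    · refine (((((hG t).const_mul (2 * i + 1 : ℝ)).add ((hasDerivAt_id t).mul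
        (((hasDerivAt_tanh t).pow (2 * i + 3)).sub ((hasDerivAt_tanh t).pow (2 * i + 1))))).add
        (((hasDerivAt_tanh t).pow (2 * i + 2)).div_const (2 * i + 2 : ℝ))).div_const
        (2 * (i + 1) + 1 : ℝ)).congr_deriv ?_
      have hc : (2 * i + 2 : ℝ) ≠ 0 := by positivity
      have hdiv (n : ℕ) : tanh t ^ n / cosh t ^ 2 = tanh t ^ n * (1 - tanh t ^ 2) := by
        rw [one_sub_tanh_sq, mul_one_div]
      simp only [hdiv, ← one_sub_tanh_sq, Pi.sub_apply, Pi.pow_apply,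
        id, show 2 * i + 3 - 1 = 2 * i + 2 from rfl, show 2 * i + 2 - 1 = 2 * i + 1 from rfl,
        show 2 * i + 1 - 1 = 2 * i from rfl]
      push_cast
      field_simp
      ring
    · have hm : Tendsto (fun t => t * (tanh t ^ (2 * i + 3) - tanh t ^ (2 * i + 1))) atTop
          (𝓝 0) := by
        have := tendsto_mul_one_sub_tanh.mul
          (((tendsto_tanh_atTop.const_add 1).mul (tendsto_tanh_atTop.pow (2 * i + 1))).neg)
        rw [zero_mul] at this
        exact this.congr fun t => by ring
      have hl := (((hlim.const_mul (2 * i + 1 : ℝ)).add hm).add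
        ((tendsto_tanh_atTop.pow (2 * i + 2)).div_const (2 * i + 2 : ℝ))).div_const
        (2 * (i + 1) + 1 : ℝ)
      convert! hl using 2
      rw [show H (i + 1) = H i + 1 / (i + 1) from Finset.sum_range_succ _ _]
      push_cast
      field_simp
      ring

theorem integral_mul_tanh_pow (i : ℕ) :
    ∫ t in Set.Ioi (0 : ℝ), t * (tanh t ^ (2 * i) / cosh t ^ 2)
      = (H i + 2 * log 2) / (2 * (2 * i + 1)) := by
  obtain ⟨G, G0, hG, hlim⟩ := exists_primitive_mul_tanh_pow i
  rw [integral_Ioi_of_hasDerivAt_of_nonneg' (fun t _ => hG t) (fun t ht => by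
    have h0 : 0 < t := ht
    have := tanh_nonneg h0.le; positivity) hlim, G0, sub_zero]
theorem sum_mul_odd_inv (n : ℕ) :
    ∑ k ∈ Finset.range (n + 1), 1 / (2 * (k : ℝ) + 1) * (1 / (2 * ((n - k : ℕ) : ℝ) + 1))
      = h (n + 1) / (n + 1) := by
  have hn : (n + 1 : ℝ) ≠ 0 := by positivity
  have hterm : ∀ k ∈ Finset.range (n + 1),
      1 / (2 * (k : ℝ) + 1) * (1 / (2 * ((n - k : ℕ) : ℝ) + 1))
        = (1 / (2 * (k : ℝ) + 1) + 1 / (2 * ((n - k : ℕ) : ℝ) + 1)) / (2 * (n + 1)) := by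
    intro k hk
    rw [Nat.cast_sub (Finset.mem_range_succ_iff.1 hk)]
    have hk' : (k : ℝ) ≤ n := by exact_mod_cast Finset.mem_range_succ_iff.1 hk
    have hp : 2 * (k : ℝ) + 1 ≠ 0 := by positivity
    have hq : 2 * ((n : ℝ) - k) + 1 ≠ 0 := by linarith
    field_simp
    ring
  rw [Finset.sum_congr rfl hterm, ← Finset.sum_div, Finset.sum_add_distrib]
  have hrefl : ∑ k ∈ Finset.range (n + 1), 1 / (2 * ((n - k : ℕ) : ℝ) + 1) = h (n + 1) := by
    simpa [h] using Finset.sum_range_reflect (fun k => 1 / (2 * (k : ℝ) + 1)) (n + 1)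
  rw [hrefl, ← h]
  field_simp
  ring

theorem hasSum_artanh {x : ℝ} (h0 : 0 ≤ x) (h1 : x < 1) :
    HasSum (fun k : ℕ => 1 / (2 * (k : ℝ) + 1) * x ^ (2 * k + 1)) (artanh x) := by
  rw [artanh_eq_half_log ⟨by linarith, h1.le⟩, log_div (by linarith) (by linarith)]
  refine ((hasSum_log_sub_log_of_abs_lt_one
    (abs_lt.2 ⟨by linarith, h1⟩)).mul_left (1 / 2 : ℝ)).congr_fun ?_
  intro k
  ring

theorem hasSum_artanh_sq {x : ℝ} (h0 : 0 ≤ x) (h1 : x < 1) :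
    HasSum (fun n : ℕ => h (n + 1) / (n + 1) * (x ^ 2) ^ (n + 1)) (artanh x ^ 2) := by
  have hs := hasSum_artanh h0 h1
  have hn : Summable fun k : ℕ => ‖1 / (2 * (k : ℝ) + 1) * x ^ (2 * k + 1)‖ := hs.summable.norm
  have hp := hasSum_sum_range_mul_of_summable_norm hn hn
  rw [hs.tsum_eq, ← sq] at hp
  convert! hp using 2 with n
  rw [← sum_mul_odd_inv, Finset.sum_mul]
  refine Finset.sum_congr rfl fun k hk => ?_
  rw [show (x ^ 2) ^ (n + 1) = x ^ (2 * k + 1) * x ^ (2 * (n - k) + 1) by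
    rw [← pow_mul, ← pow_add]
    have := Finset.mem_range_succ_iff.1 hk
    congr 1
    lia]
  ring

theorem hasSum_sq_mul_tanh {t : ℝ} (ht : 0 ≤ t) :
    HasSum (fun i : ℕ => (∑ k ∈ Finset.range i, h (k + 1) / ((k : ℝ) + 1))
      * (tanh t ^ (2 * i) / cosh t ^ 2)) (t ^ 2) := by
  have h0 := tanh_nonneg ht
  have h1 := tanh_lt_one t
  have hc := (cosh_pos t).ne'
  have hsq := hasSum_artanh_sq h0 h1
  rw [artanh_tanh] at hsq
  have hx : ‖tanh t ^ 2‖ < 1 := by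
    rw [Real.norm_of_nonneg (by positivity)]
    exact pow_lt_one₀ h0 h1 two_ne_zero
  have hp := hasSum_sum_range_mul_of_summable_norm hsq.summable.norm
    (summable_norm_geometric_of_norm_lt_one hx)
  rw [hsq.tsum_eq, tsum_geometric_of_norm_lt_one hx] at hp
  rw [← hasSum_nat_add_iff' 1]
  convert! hp.div_const (cosh t ^ 2) using 1
  · ext n
    rw [Finset.sum_mul, Finset.sum_div]
    refine Finset.sum_congr rfl fun k hk => ?_
    rw [pow_mul, mul_assoc, ← pow_add, mul_div_assoc]
    have := Finset.mem_range_succ_iff.1 hk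
    rw [show k + 1 + (n - k) = n + 1 by lia]
  · rw [one_sub_tanh_sq]
    simp [hc]

theorem sum_odd_harmonic_div_nonneg (i : ℕ) :
    0 ≤ ∑ k ∈ Finset.range i, h (k + 1) / ((k : ℝ) + 1) :=
  Finset.sum_nonneg fun k _ =>
    div_nonneg (Finset.sum_nonneg fun j _ => by positivity) (by positivity)

theorem hasSum_cube {t : ℝ} (ht : 0 ≤ t) :
    HasSum (fun i : ℕ => (∑ k ∈ Finset.range i, h (k + 1) / ((k : ℝ) + 1))
      * (tanh t ^ (2 * i + 1) / (2 * i + 1))) (t ^ 3 / 3) := by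
  have hs := hasSum_setIntegral_of_nonneg (s := Set.Ioc 0 t) measurableSet_Ioc
    (F := fun i x => (∑ k ∈ Finset.range i, h (k + 1) / ((k : ℝ) + 1))
      * (tanh x ^ (2 * i) / cosh x ^ 2))
    (fun i => (continuous_tanh_pow_div i).const_mul _)
    (fun i x hx => mul_nonneg (sum_odd_harmonic_div_nonneg i) (by
      have := tanh_nonneg hx.1.le; positivity))
    (fun x hx => hasSum_sq_mul_tanh hx.1.le)
    ((continuous_pow 2).integrableOn_Ioc)
  convert! hs using 1
  · ext i
    rw [integral_const_mul, ← intervalIntegral.integral_of_le ht,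
      intervalIntegral.integral_eq_sub_of_hasDerivAt (fun x _ => hasDerivAt_tanh_pow_div i x)
        ((continuous_tanh_pow_div i).intervalIntegrable _ _)]
    simp
  · rw [← intervalIntegral.integral_of_le ht, integral_pow]
    norm_num

theorem hasSum_cube_div {t : ℝ} (ht : 0 < t) :
    HasSum (fun i : ℕ => (∑ k ∈ Finset.range i, h (k + 1) / ((k : ℝ) + 1)) / (2 * i + 1)
      * (tanh t ^ (2 * i) / cosh t ^ 2)) (t ^ 3 / (sinh t * cosh t) / 3) := by
  have hs := sinh_pos_iff.2 ht
  have hc := cosh_pos t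
  have hT : 0 < tanh t := by rw [tanh_eq_sinh_div_cosh]; positivity
  convert! (hasSum_cube ht.le).div_const (tanh t * cosh t ^ 2) using 1
  · ext i
    field_simp
    ring
  · rw [tanh_eq_sinh_div_cosh]
    field_simp

theorem integrableOn_pow_div_sinh_mul_cosh (m : ℕ) :
    IntegrableOn (fun t : ℝ => t ^ (m + 1) / (sinh t * cosh t)) (Set.Ioi 0) := by
  have hg : IntegrableOn (fun t : ℝ => 2 * (exp (-t) * t ^ ((m + 1 : ℝ) - 1))) (Set.Ioi 0) :=
    (GammaIntegral_convergent (by positivity)).const_mul 2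
  refine Integrable.mono' hg ?_ ?_
  · exact (by fun_prop : Measurable fun t : ℝ =>
      t ^ (m + 1) / (sinh t * cosh t)).aestronglyMeasurable
  · filter_upwards [ae_restrict_mem measurableSet_Ioi] with t ht
    have h0 : 0 < t := ht
    have hs := sinh_pos_iff.2 h0
    have hts : t ≤ sinh t := self_le_sinh_iff.2 h0.le
    have hc : exp t ≤ 2 * cosh t := by
      rw [cosh_eq]
      linarith [exp_pos (-t)]
    rw [Real.norm_of_nonneg (by positivity), add_sub_cancel_right, rpow_natCast,
      div_le_iff₀ (by positivity), exp_neg]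
    calc t ^ (m + 1) = t ^ m * t * ((exp t)⁻¹ * exp t) := by
          rw [inv_mul_cancel₀ (exp_pos t).ne', mul_one, pow_succ]
      _ ≤ t ^ m * sinh t * ((exp t)⁻¹ * (2 * cosh t)) := by gcongr
      _ = _ := by ring

theorem hasSum_exp_odd {t : ℝ} (ht : 0 < t) :
    HasSum (fun k : ℕ => 4 * exp (-((4 * k + 2) * t))) (1 / (sinh t * cosh t)) := by
  have hq : exp (-(4 * t)) < 1 := exp_lt_one_iff.2 (by linarith)
  convert! (hasSum_geometric_of_lt_one (exp_pos _).le hq).mul_left (4 * exp (-(2 * t))) using 1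
  · ext k
    rw [mul_assoc, ← exp_nat_mul, ← exp_add]
    ring_nf
  · have hs := sinh_pos_iff.2 ht
    have hc := cosh_pos t
    have hsub : 1 - exp (-(4 * t)) ≠ 0 := by linarith
    have h4 : exp (-(4 * t)) = exp (-t) ^ 4 := by rw [← exp_nat_mul]; push_cast; ring_nf
    have h2 : exp (-(2 * t)) = exp (-t) ^ 2 := by rw [← exp_nat_mul]; push_cast; ring_nf
    have he : exp t * exp (-t) = 1 := by rw [← exp_add]; simp
    field_simp
    rw [h4, h2, sinh_eq, cosh_eq]
    linear_combination (-(exp t * exp (-t)) - 1) * he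

theorem hasSum_odd_pow {s : ℕ} (hs : 1 < s) :
    HasSum (fun k : ℕ => 1 / (2 * (k : ℝ) + 1) ^ s) ((1 - 1 / 2 ^ s) * zeta s) := by
  have hf : Summable fun n : ℕ => 1 / ((n : ℝ) + 1) ^ s := by
    simpa using (summable_nat_add_iff 1).2 (summable_one_div_nat_pow.2 hs)
  have hodd : HasSum (fun k : ℕ => 1 / (((2 * k + 1 : ℕ) : ℝ) + 1) ^ s) (1 / 2 ^ s * zeta s) := by
    convert! hf.hasSum.mul_left (1 / 2 ^ s) using 1
    ext k
    push_cast
    rw [one_div_mul_one_div, ← mul_pow]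
    ring_nf
  have heven : Summable fun k : ℕ => 1 / (2 * (k : ℝ) + 1) ^ s := by
    simpa [Function.comp_def] using
      hf.comp_injective (i := fun k : ℕ => 2 * k) fun a b hab => by simpa using hab
  have hsum : HasSum (fun k : ℕ => 1 / (((2 * k : ℕ) : ℝ) + 1) ^ s)
      (∑' k : ℕ, 1 / (2 * (k : ℝ) + 1) ^ s) := by
    simpa using heven.hasSum
  have hz : _ + 1 / 2 ^ s * zeta s = zeta s :=
    (HasSum.even_add_odd (f := fun n : ℕ => 1 / ((n : ℝ) + 1) ^ s) hsum hodd).unique hf.hasSum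
  rw [show (1 - 1 / 2 ^ s) * zeta s = ∑' k : ℕ, 1 / (2 * (k : ℝ) + 1) ^ s by
    linear_combination -hz]
  exact heven.hasSum

theorem integral_pow_div_sinh_mul_cosh (m : ℕ) :
    ∫ t in Set.Ioi (0 : ℝ), t ^ (m + 1) / (sinh t * cosh t)
      = 4 * (m + 1).factorial / 2 ^ (m + 2) * ((1 - 1 / 2 ^ (m + 2)) * zeta (m + 2)) := by
  have hs := hasSum_setIntegral_of_nonneg (s := Set.Ioi 0) measurableSet_Ioi
    (F := fun k t => t ^ (m + 1) * (4 * exp (-((4 * k + 2) * t))))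
    (fun k => by fun_prop) (fun k t ht => by have : 0 < t := ht; positivity)
    (fun t ht => by
      rw [← mul_one_div]
      exact (hasSum_exp_odd ht).mul_left (t ^ (m + 1)))
    (integrableOn_pow_div_sinh_mul_cosh m)
  have ho := (hasSum_odd_pow (s := m + 2) (by lia)).mul_left
    (4 * (m + 1).factorial / 2 ^ (m + 2) : ℝ)
  refine hs.unique ?_
  convert! ho using 1
  ext k
  have hr : (0 : ℝ) < 4 * k + 2 := by positivity
  have hg := integral_rpow_mul_exp_neg_mul_Ioi (a := (m + 1 : ℕ) + 1) (by positivity) hr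
  rw [Gamma_nat_eq_factorial, add_sub_cancel_right, ← Nat.cast_add_one, rpow_natCast] at hg
  simp only [rpow_natCast] at hg
  simp only [mul_left_comm _ (4 : ℝ), integral_const_mul, hg]
  rw [show (4 * k + 2 : ℝ) = 2 * (2 * k + 1) by ring, one_div_pow, mul_pow]
  field_simp

theorem hasSum_odd_harmonic_div_sq :
    HasSum (fun i : ℕ => (∑ k ∈ Finset.range i, h (k + 1) / ((k : ℝ) + 1)) / (2 * i + 1)
      * (1 / (2 * i + 1))) (15 / 32 * zeta 4) := by
  have hs := hasSum_setIntegral_of_nonneg (s := Set.Ioi 0) measurableSet_Ioi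
    (fun i => (continuous_tanh_pow_div i).const_mul _)
    (fun i t ht => mul_nonneg (div_nonneg (sum_odd_harmonic_div_nonneg i) (by positivity)) (by
      have := tanh_nonneg (le_of_lt ht); positivity))
    (fun t ht => hasSum_cube_div ht) ((integrableOn_pow_div_sinh_mul_cosh 2).div_const 3)
  simp only [integral_const_mul, integral_tanh_pow, integral_div,
    integral_pow_div_sinh_mul_cosh] at hs
  convert! hs using 1
  norm_num [Nat.factorial]
  ring

theorem hasSum_odd_harmonic_mul_harmonic :
    HasSum (fun i : ℕ => (∑ k ∈ Finset.range i, h (k + 1) / ((k : ℝ) + 1)) / (2 * i + 1)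
      * ((H i + 2 * log 2) / (2 * (2 * i + 1)))) (31 / 32 * zeta 5) := by
  have hs := hasSum_setIntegral_of_nonneg (s := Set.Ioi 0) measurableSet_Ioi
    (F := fun i t => (∑ k ∈ Finset.range i, h (k + 1) / ((k : ℝ) + 1)) / (2 * i + 1)
      * (t * (tanh t ^ (2 * i) / cosh t ^ 2)))
    (f := fun t => t ^ (3 + 1) / (sinh t * cosh t) / 3)
    (fun i => (continuous_id.mul (continuous_tanh_pow_div i)).const_mul _)
    (fun i t ht => mul_nonneg (div_nonneg (sum_odd_harmonic_div_nonneg i) (by positivity)) (by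
      have h0 : 0 < t := ht
      have := tanh_nonneg h0.le
      positivity))
    (fun t ht => by
      convert! (hasSum_cube_div ht).mul_left t using 1
      · ext i
        ring
      · ring) ((integrableOn_pow_div_sinh_mul_cosh 3).div_const 3)
  simp only [integral_const_mul, integral_mul_tanh_pow, integral_div,
    integral_pow_div_sinh_mul_cosh] at hs
  convert! hs using 1
  norm_num [Nat.factorial]

theorem stmt9 :
    HasSum (fun i : ℕ => H (i + 1) / (2 * (i : ℝ) + 3) ^ 2
        * (∑ k ∈ Finset.range (i + 1), h (k + 1) / ((k : ℝ) + 1)))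
      ((31 / 16) * zeta 5 - (15 / 16) * Real.log 2 * zeta 4) := by
  have hs := (hasSum_odd_harmonic_mul_harmonic.mul_left 2).sub
    (hasSum_odd_harmonic_div_sq.mul_left (2 * log 2))
  rw [← hasSum_nat_add_iff' 1] at hs
  convert! hs using 1
  · ext i
    push_cast
    rw [show 2 * ((i : ℝ) + 1) + 1 = 2 * i + 3 by ring]
    field_simp
    ring
  · simp
    ring
end

section
/- The identity ∑_{k=1}^∞ (h_k/k³)·(∑_{i=1}^k h_i/i) = -(49/32)·ζ(3)² + 2·ln(2)·∑_{k=1}^∞ h_k²/k³ + ∑_{k=1}^∞ H_k·h_k²/k³ holds, all series being convergent. -/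
open Finset Real

open Filter Topology

lemma H_succ (n : ℕ) : H (n + 1) = H n + 1 / ((n : ℝ) + 1) := Finset.sum_range_succ _ _

lemma h_succ (n : ℕ) : h (n + 1) = h n + 1 / (2 * (n : ℝ) + 1) := Finset.sum_range_succ _ _

lemma H_nonneg (n : ℕ) : 0 ≤ H n := Finset.sum_nonneg fun _ _ => by positivity

lemma h_nonneg (n : ℕ) : 0 ≤ h n := Finset.sum_nonneg fun _ _ => by positivity

lemma h_le_H (n : ℕ) : h n ≤ H n := by
  refine Finset.sum_le_sum fun j _ => ?_
  gcongr
  linarith [(Nat.cast_nonneg j : (0 : ℝ) ≤ j)]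

lemma H_mono : Monotone H := monotone_nat_of_le_succ fun n => by
  rw [H_succ]
  exact le_add_of_nonneg_right (by positivity)

lemma H_two_mul (n : ℕ) : H (2 * n) = h n + H n / 2 := by
  induction n with
  | zero => simp [H, h]
  | succ n ih =>
    rw [show 2 * (n + 1) = 2 * n + 1 + 1 by ring, H_succ, H_succ, ih, h_succ, H_succ]
    push_cast
    field_simp
    ring

lemma H_le_two_mul_sqrt (n : ℕ) : H n ≤ 2 * √(n : ℝ) := by
  induction n with
  | zero => simp [H]
  | succ n ih =>
    rw [H_succ]
    push_cast
    have hn : (0 : ℝ) ≤ n := Nat.cast_nonneg n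
    have ha := Real.sq_sqrt hn
    have hb := Real.sq_sqrt (by linarith : (0 : ℝ) ≤ n + 1)
    have ha0 := Real.sqrt_nonneg (n : ℝ)
    have hb1 : 1 ≤ √((n : ℝ) + 1) := Real.one_le_sqrt.2 (by linarith)
    have hab : √(n : ℝ) ≤ √((n : ℝ) + 1) := Real.sqrt_le_sqrt (by linarith)
    have key : 1 / ((n : ℝ) + 1) ≤ 2 * √((n : ℝ) + 1) - 2 * √(n : ℝ) := by
      rw [div_le_iff₀ (by positivity)]
      nlinarith [mul_nonneg (sub_nonneg.2 hab) (sub_nonneg.2 hb1),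
        mul_nonneg (sub_nonneg.2 hab) (sub_nonneg.2 hab)]
    linarith

/-- The comparison series for all single sums. -/
lemma summable_sqrt_pow_div : Summable fun k : ℕ => √((k : ℝ) + 1) / ((k : ℝ) + 1) ^ 2 := by
  have := (summable_nat_add_iff 1).2 (Real.summable_one_div_nat_rpow.2 (by norm_num : (1 : ℝ) < 3 / 2))
  refine this.congr fun k => ?_
  have hk : (0 : ℝ) < (k : ℝ) + 1 := by positivity
  push_cast
  rw [Real.sqrt_eq_rpow, ← Real.rpow_natCast, ← Real.rpow_sub hk, one_div, ← Real.rpow_neg hk.le]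
  norm_num

lemma summable_of_le_sqrt {f : ℕ → ℝ} (c : ℝ) (hf : ∀ k, 0 ≤ f k)
    (hle : ∀ k : ℕ, f k ≤ c * √((k : ℝ) + 1) / ((k : ℝ) + 1) ^ 2) : Summable f :=
  Summable.of_nonneg_of_le hf (fun k => (hle k).trans_eq (mul_div_assoc _ _ _))
    (summable_sqrt_pow_div.mul_left c)

lemma summable_H_div_sq : Summable fun k : ℕ => H (k + 1) / ((k : ℝ) + 1) ^ 2 := by
  refine summable_of_le_sqrt 2 (fun k => div_nonneg (H_nonneg _) (by positivity)) fun k => ?_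
  gcongr
  exact_mod_cast H_le_two_mul_sqrt (k + 1)

lemma summable_h_div_sq : Summable fun k : ℕ => h (k + 1) / ((k : ℝ) + 1) ^ 2 :=
  Summable.of_nonneg_of_le (fun k => div_nonneg (h_nonneg _) (by positivity))
    (fun k => by gcongr; exact h_le_H _) summable_H_div_sq

lemma summable_H_cube_div_cube : Summable fun k : ℕ => H (k + 1) ^ 3 / ((k : ℝ) + 1) ^ 3 := by
  refine summable_of_le_sqrt 8
    (fun k => div_nonneg (pow_nonneg (H_nonneg _) _) (by positivity)) fun k => ?_
  have hk : (0 : ℝ) < (k : ℝ) + 1 := by positivity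
  have h1 : H (k + 1) ^ 3 ≤ (2 * √((k : ℝ) + 1)) ^ 3 := by
    gcongr
    · exact H_nonneg _
    · exact_mod_cast H_le_two_mul_sqrt (k + 1)
  have h2 : (2 * √((k : ℝ) + 1)) ^ 3 = 8 * √((k : ℝ) + 1) * ((k : ℝ) + 1) := by
    linear_combination 8 * √((k : ℝ) + 1) * Real.sq_sqrt hk.le
  rw [div_le_div_iff₀ (by positivity) (by positivity)]
  calc H (k + 1) ^ 3 * ((k : ℝ) + 1) ^ 2
      ≤ (8 * √((k : ℝ) + 1) * ((k : ℝ) + 1)) * ((k : ℝ) + 1) ^ 2 := by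
        rw [← h2]; gcongr
    _ = 8 * √((k : ℝ) + 1) * ((k : ℝ) + 1) ^ 3 := by ring

lemma summable_of_le_H_cube {f : ℕ → ℝ} (hf : ∀ k, 0 ≤ f k)
    (hle : ∀ k : ℕ, f k ≤ H (k + 1) ^ 3) : Summable fun k : ℕ => f k / ((k : ℝ) + 1) ^ 3 :=
  Summable.of_nonneg_of_le (fun k => div_nonneg (hf k) (by positivity))
    (fun k => by gcongr; exact hle k) summable_H_cube_div_cube

lemma one_le_H (k : ℕ) : 1 ≤ H (k + 1) := by
  have : H 1 = 1 := by simp [H]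
  exact this ▸ H_mono (by omega)

lemma summable_h_sq_div_cube : Summable fun k : ℕ => h (k + 1) ^ 2 / ((k : ℝ) + 1) ^ 3 := by
  refine summable_of_le_H_cube (fun k => sq_nonneg _) fun k => ?_
  calc h (k + 1) ^ 2 ≤ H (k + 1) ^ 2 := by
        gcongr
        · exact h_nonneg _
        · exact h_le_H _
    _ ≤ H (k + 1) ^ 3 := pow_le_pow_right₀ (one_le_H k) (by norm_num)

lemma summable_H_mul_h_sq_div_cube :
    Summable fun k : ℕ => H (k + 1) * h (k + 1) ^ 2 / ((k : ℝ) + 1) ^ 3 := by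
  refine summable_of_le_H_cube (fun k => mul_nonneg (H_nonneg _) (sq_nonneg _)) fun k => ?_
  calc H (k + 1) * h (k + 1) ^ 2 ≤ H (k + 1) * H (k + 1) ^ 2 := by
        gcongr
        · exact H_nonneg _
        · exact h_nonneg _
        · exact h_le_H _
    _ = H (k + 1) ^ 3 := by ring

lemma sum_h_div_le (k : ℕ) :
    ∑ i ∈ Finset.range k, h (i + 1) / ((i : ℝ) + 1) ≤ H k ^ 2 := by
  rw [sq]
  nth_rewrite 2 [H]
  rw [Finset.mul_sum]
  refine Finset.sum_le_sum fun i hi => ?_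
  rw [mul_one_div]
  gcongr
  exact (h_le_H _).trans (H_mono (Finset.mem_range.1 hi))

lemma sum_h_div_nonneg (k : ℕ) : 0 ≤ ∑ i ∈ Finset.range k, h (i + 1) / ((i : ℝ) + 1) :=
  Finset.sum_nonneg fun _ _ => div_nonneg (h_nonneg _) (by positivity)

lemma summable_h_mul_sum_div_cube :
    Summable fun k : ℕ => h (k + 1) / ((k : ℝ) + 1) ^ 3
      * (∑ i ∈ Finset.range (k + 1), h (i + 1) / ((i : ℝ) + 1)) := by
  refine (summable_of_le_H_cube
    (f := fun k => h (k + 1) * ∑ i ∈ Finset.range (k + 1), h (i + 1) / ((i : ℝ) + 1))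
    (fun k => mul_nonneg (h_nonneg _) (sum_h_div_nonneg _)) fun k => ?_).congr fun k => by ring
  calc h (k + 1) * ∑ i ∈ Finset.range (k + 1), h (i + 1) / ((i : ℝ) + 1)
      ≤ H (k + 1) * H (k + 1) ^ 2 :=
        mul_le_mul (h_le_H _) (sum_h_div_le _) (sum_h_div_nonneg _) (H_nonneg _)
    _ = H (k + 1) ^ 3 := by ring

lemma summable_one_div_cube : Summable fun k : ℕ => (1 : ℝ) / ((k : ℝ) + 1) ^ 3 := by
  refine summable_of_le_H_cube (f := fun _ => 1) (fun _ => zero_le_one) fun k => ?_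
  exact one_le_pow₀ (one_le_H k)

/-- Telescoping with step `k`. -/
lemma hasSum_sub_shift {g : ℕ → ℝ} (hg : Antitone g) (h0 : Tendsto g atTop (𝓝 0)) (k : ℕ) :
    HasSum (fun n => g n - g (n + k)) (∑ j ∈ Finset.range k, g j) := by
  induction k with
  | zero => simp
  | succ k ih =>
    have step : HasSum (fun n => g (n + k) - g (n + (k + 1))) (g k) := by
      rw [hasSum_iff_tendsto_nat_of_nonneg fun n => sub_nonneg.2 (hg (by omega))]
      have : ∀ N, ∑ n ∈ Finset.range N, (g (n + k) - g (n + (k + 1))) = g k - g (N + k) := by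
        intro N
        have := Finset.sum_range_sub' (fun n => g (n + k)) N
        simp only [zero_add] at this
        rw [← this]
        exact Finset.sum_congr rfl fun n _ => by rw [add_right_comm, add_assoc]
      simp only [this]
      simpa using tendsto_const_nhds.sub ((tendsto_add_atTop_iff_nat k).2 h0)
    rw [Finset.sum_range_succ]
    exact (ih.add step).congr_fun fun n => by ring

lemma tendsto_one_div_add_const (c : ℝ) : Tendsto (fun n : ℕ => 1 / ((n : ℝ) + c)) atTop (𝓝 0) :=
  tendsto_const_nhds.div_atTop (tendsto_atTop_add_const_right _ _ tendsto_natCast_atTop_atTop)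

/-- `H k = ∑ (1 / n - 1 / (n + k))`. -/
lemma hasSum_H (k : ℕ) :
    HasSum (fun n : ℕ => 1 / ((n : ℝ) + 1) - 1 / ((n : ℝ) + k + 1)) (H k) := by
  have hg : Antitone fun n : ℕ => 1 / ((n : ℝ) + 1) := fun a b hab => by
    dsimp only
    gcongr
  refine (hasSum_sub_shift hg (tendsto_one_div_add_const 1) k).congr_fun fun n => ?_
  push_cast
  rfl

lemma hasSum_h (k : ℕ) :
    HasSum (fun n : ℕ => 1 / (2 * (n : ℝ) + 1) - 1 / (2 * ((n : ℝ) + k) + 1)) (h k) := by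
  have hg : Antitone fun n : ℕ => 1 / (2 * (n : ℝ) + 1) := fun a b hab => by
    dsimp only
    gcongr
  have h0 : Tendsto (fun n : ℕ => 1 / (2 * (n : ℝ) + 1)) atTop (𝓝 0) := by
    refine tendsto_const_nhds.div_atTop (tendsto_atTop_add_const_right _ _ ?_)
    exact tendsto_natCast_atTop_atTop.const_mul_atTop (by norm_num)
  refine (hasSum_sub_shift hg h0 k).congr_fun fun n => ?_
  push_cast
  rfl

lemma harmonic_eq_H (n : ℕ) : (harmonic n : ℝ) = H n := by
  simp [harmonic, H]

lemma hasSum_log_two :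
    HasSum (fun n : ℕ => 1 / (2 * (n : ℝ) + 1) - 1 / (2 * (n : ℝ) + 2)) (Real.log 2) := by
  rw [hasSum_iff_tendsto_nat_of_nonneg fun n => ?_]
  · have hpart : ∀ N : ℕ, ∑ n ∈ Finset.range N, (1 / (2 * (n : ℝ) + 1) - 1 / (2 * (n : ℝ) + 2))
        = H (2 * N) - H N := by
      intro N
      induction N with
      | zero => simp [H]
      | succ N ih =>
        rw [Finset.sum_range_succ, ih, H_two_mul, H_two_mul, h_succ, H_succ]
        field_simp
        ring
    have hlim : Tendsto (fun n : ℕ => H n - Real.log n) atTop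
        (𝓝 Real.eulerMascheroniConstant) := by
      simpa only [harmonic_eq_H] using Real.tendsto_harmonic_sub_log
    have h2N : Tendsto (fun N : ℕ => 2 * N) atTop atTop :=
      tendsto_id.const_mul_atTop' (by norm_num)
    have := ((hlim.comp h2N).sub hlim).add_const (Real.log 2)
    simp only [sub_self, zero_add] at this
    refine this.congr' ?_
    filter_upwards [eventually_gt_atTop 0] with N hN
    have hN' : (N : ℝ) ≠ 0 := by positivity
    rw [hpart]
    simp only [Function.comp_apply]
    push_cast
    rw [Real.log_mul two_ne_zero hN']
    ring
  · rw [sub_nonneg]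
    gcongr
    norm_num

lemma hasSum_log_two_add_H (k : ℕ) :
    HasSum (fun n : ℕ => 1 / ((2 * (n : ℝ) + 1) * ((n : ℝ) + k + 1)))
      ((2 * Real.log 2 + H k) / (2 * k + 1)) := by
  have := ((hasSum_log_two.mul_left 2).add (hasSum_H k)).div_const (2 * (k : ℝ) + 1)
  refine this.congr_fun fun n => ?_
  field_simp
  ring

lemma tendsto_h_mul (k : ℕ) :
    Tendsto (fun N : ℕ => h N * (1 / ((N : ℝ) + k + 1))) atTop (𝓝 0) := by
  have hs : Tendsto (fun N : ℕ => 2 / √(N : ℝ)) atTop (𝓝 0) :=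
    tendsto_const_nhds.div_atTop (Real.tendsto_sqrt_atTop.comp tendsto_natCast_atTop_atTop)
  refine squeeze_zero' (Eventually.of_forall fun N => mul_nonneg (h_nonneg N) (by positivity))
    ?_ hs
  filter_upwards [eventually_gt_atTop 0] with N hN
  have hN' : (0 : ℝ) < N := by exact_mod_cast hN
  have hb := (h_le_H N).trans (H_le_two_mul_sqrt N)
  have hsq := Real.sq_sqrt hN'.le
  have hpos := Real.sqrt_pos.2 hN'
  rw [mul_one_div, div_le_div_iff₀ (by positivity) hpos]
  have hk : (0 : ℝ) ≤ k := Nat.cast_nonneg k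
  nlinarith [mul_le_mul_of_nonneg_right hb hpos.le]

/-- Summation by parts against `h`. -/
lemma hasSum_h_mul_sub (k : ℕ) :
    HasSum (fun n : ℕ => h (n + 1) * (1 / ((n : ℝ) + k + 1) - 1 / ((n : ℝ) + (k + 1) + 1)))
      ((2 * Real.log 2 + H k) / (2 * k + 1)) := by
  rw [hasSum_iff_tendsto_nat_of_nonneg fun n => ?_]
  · have hpart : ∀ N : ℕ, ∑ n ∈ Finset.range N,
        h (n + 1) * (1 / ((n : ℝ) + k + 1) - 1 / ((n : ℝ) + (k + 1) + 1))
        = ∑ n ∈ Finset.range N, 1 / ((2 * (n : ℝ) + 1) * ((n : ℝ) + k + 1))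
          - h N * (1 / ((N : ℝ) + k + 1)) := by
      intro N
      induction N with
      | zero => simp [h]
      | succ N ih =>
        rw [Finset.sum_range_succ, ih, Finset.sum_range_succ, h_succ]
        push_cast
        field_simp
        ring
    simp only [hpart]
    simpa using (hasSum_log_two_add_H k).tendsto_sum_nat.sub (tendsto_h_mul k)
  · refine mul_nonneg (h_nonneg _) (sub_nonneg.2 ?_)
    gcongr
    linarith

lemma hasSum_h_mul_one_div_sub (k : ℕ) :
    HasSum (fun n : ℕ => h (n + 1) * (1 / ((n : ℝ) + 1) - 1 / ((n : ℝ) + k + 1)))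
      (2 * Real.log 2 * h k + H k * h k - ∑ i ∈ Finset.range k, h (i + 1) / ((i : ℝ) + 1)) := by
  induction k with
  | zero => simp [h, H]
  | succ k ih =>
    convert ih.add (hasSum_h_mul_sub k) using 1
    · ext n
      push_cast
      ring
    · rw [Finset.sum_range_succ, h_succ, H_succ]
      field_simp
      ring

lemma tsum_prod_eq_antidiagonal {f : ℕ × ℕ → ℝ} (hf : Summable f) :
    ∑' x, f x = ∑' n, ∑ x ∈ Finset.HasAntidiagonal.antidiagonal n, f x := by
  rw [← (Finset.HasAntidiagonal.sigmaAntidiagonalEquivProd (A := ℕ)).tsum_eq f]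
  refine (Summable.tsum_sigma' (fun n => (hasSum_fintype _).summable)
    (Finset.HasAntidiagonal.sigmaAntidiagonalEquivProd.summable_iff.2 hf)).trans ?_
  refine tsum_congr fun n => ?_
  rw [tsum_fintype]
  exact Finset.sum_coe_sort (Finset.HasAntidiagonal.antidiagonal n) f

lemma tsum_even_add_tsum_odd {f : ℕ → ℝ} (hf : Summable f) :
    ∑' n, f n = ∑' n, f (2 * n) + ∑' n, f (2 * n + 1) :=
  (tsum_even_add_odd (hf.comp_injective (mul_right_injective₀ two_ne_zero))
    (hf.comp_injective ((add_left_injective 1).comp (mul_right_injective₀ two_ne_zero)))).symm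

lemma tsum_prod_parity {f : ℕ × ℕ → ℝ} (hf : Summable f) :
    ∑' x, f x = (∑' x : ℕ × ℕ, f (2 * x.1, 2 * x.2) + ∑' x : ℕ × ℕ, f (2 * x.1, 2 * x.2 + 1))
      + (∑' x : ℕ × ℕ, f (2 * x.1 + 1, 2 * x.2)
        + ∑' x : ℕ × ℕ, f (2 * x.1 + 1, 2 * x.2 + 1)) := by
  have he : Function.Injective fun n : ℕ => 2 * n := mul_right_injective₀ two_ne_zero
  have ho : Function.Injective fun n : ℕ => 2 * n + 1 := (add_left_injective 1).comp he
  have key : ∀ u : ℕ → ℕ, Function.Injective u →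
      ∑' i, ∑' q, f (u i, q)
        = ∑' x : ℕ × ℕ, f (u x.1, 2 * x.2) + ∑' x : ℕ × ℕ, f (u x.1, 2 * x.2 + 1) := by
    intro u hu
    have s1 : Summable fun x : ℕ × ℕ => f (u x.1, 2 * x.2) := hf.comp_injective (hu.prodMap he)
    have s2 : Summable fun x : ℕ × ℕ => f (u x.1, 2 * x.2 + 1) :=
      hf.comp_injective (hu.prodMap ho)
    rw [s1.tsum_prod, s2.tsum_prod, ← s1.prod.tsum_add s2.prod]
    exact tsum_congr fun i => tsum_even_add_tsum_odd (hf.prod_factor (u i))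
  rw [← key _ he, ← key _ ho, hf.tsum_prod]
  exact tsum_even_add_tsum_odd hf.prod

/-- Tornheim's kernel `1 / (a b (a + b))` at `a = x.1 + 1`, `b = x.2 + 1`. -/
noncomputable def tornheim (x : ℕ × ℕ) : ℝ :=
  1 / (((x.1 : ℝ) + 1) * ((x.2 : ℝ) + 1) * ((x.1 : ℝ) + x.2 + 2))

lemma hasSum_tornheim_fiber (p : ℕ) :
    HasSum (fun q : ℕ => tornheim (p, q)) (H (p + 1) / ((p : ℝ) + 1) ^ 2) := by
  refine ((hasSum_H (p + 1)).div_const (((p : ℝ) + 1) ^ 2)).congr_fun fun q => ?_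
  simp only [tornheim]
  push_cast
  rw [show (p : ℝ) + q + 2 = q + (p + 1) + 1 by ring]
  field_simp
  ring

lemma summable_tornheim : Summable tornheim := by
  rw [summable_prod_of_nonneg fun x => by simp only [tornheim, Pi.zero_apply]; positivity]
  refine ⟨fun p => (hasSum_tornheim_fiber p).summable, ?_⟩
  simpa only [(hasSum_tornheim_fiber _).tsum_eq] using summable_H_div_sq

lemma tsum_tornheim : ∑' x, tornheim x = ∑' k : ℕ, H (k + 1) / ((k : ℝ) + 1) ^ 2 := by
  rw [summable_tornheim.tsum_prod]
  exact tsum_congr fun p => (hasSum_tornheim_fiber p).tsum_eq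

lemma sum_antidiagonal_add (u : ℕ → ℝ) (n : ℕ) :
    ∑ x ∈ Finset.HasAntidiagonal.antidiagonal n, (u x.1 + u x.2)
      = 2 * ∑ j ∈ Finset.range (n + 1), u j := by
  rw [Finset.sum_add_distrib, two_mul]
  congr 1
  · exact Finset.Nat.sum_antidiagonal_eq_sum_range_succ (fun i _ => u i) n
  · rw [← Finset.Nat.sum_antidiagonal_swap]
    exact Finset.Nat.sum_antidiagonal_eq_sum_range_succ (fun i _ => u i) n

lemma tsum_tornheim_antidiagonal :
    ∑' x, tornheim x = 2 * ∑' n : ℕ, H (n + 1) / ((n : ℝ) + 2) ^ 2 := by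
  rw [tsum_prod_eq_antidiagonal summable_tornheim, ← tsum_mul_left]
  refine tsum_congr fun n => ?_
  rw [H, ← mul_div_assoc, ← sum_antidiagonal_add, Finset.sum_div]
  refine Finset.sum_congr rfl fun x hx => ?_
  have hx' : (n : ℝ) = x.1 + x.2 := by exact_mod_cast (Finset.HasAntidiagonal.mem_antidiagonal.1 hx).symm
  rw [hx', tornheim]
  field_simp
  ring

lemma tsum_H_div_sq : ∑' k : ℕ, H (k + 1) / ((k : ℝ) + 1) ^ 2 = 2 * zeta 3 := by
  have hs : Summable fun n : ℕ => H n / ((n : ℝ) + 1) ^ 2 :=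
    (summable_H_div_sq.sub summable_one_div_cube).congr fun n => by
      rw [H_succ]
      field_simp
      ring
  have e1 : ∑' n : ℕ, H n / ((n : ℝ) + 1) ^ 2
      = ∑' k : ℕ, H (k + 1) / ((k : ℝ) + 1) ^ 2 - zeta 3 := by
    rw [zeta, ← summable_H_div_sq.tsum_sub summable_one_div_cube]
    refine tsum_congr fun n => ?_
    rw [H_succ]
    field_simp
    ring
  have e2 : ∑' n : ℕ, H n / ((n : ℝ) + 1) ^ 2 = ∑' n : ℕ, H (n + 1) / ((n : ℝ) + 2) ^ 2 := by
    rw [hs.tsum_eq_zero_add]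
    simp only [H, Finset.range_zero, Finset.sum_empty, zero_div, zero_add]
    refine tsum_congr fun n => ?_
    push_cast
    ring
  have e3 := tsum_tornheim.symm.trans tsum_tornheim_antidiagonal
  linarith

lemma tsum_tornheim_even_even :
    ∑' x : ℕ × ℕ, tornheim (2 * x.1 + 1, 2 * x.2 + 1) = (∑' x, tornheim x) / 8 := by
  rw [← tsum_div_const]
  refine tsum_congr fun x => ?_
  simp only [tornheim]
  push_cast
  field_simp
  ring

lemma tsum_tornheim_odd_odd :
    ∑' x : ℕ × ℕ, tornheim (2 * x.1, 2 * x.2)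
      = (∑' k : ℕ, h (k + 1) / ((k : ℝ) + 1) ^ 2) / 2 := by
  have he : Function.Injective fun n : ℕ => 2 * n := mul_right_injective₀ two_ne_zero
  have hs : Summable fun x : ℕ × ℕ => tornheim (2 * x.1, 2 * x.2) :=
    summable_tornheim.comp_injective (he.prodMap he)
  rw [tsum_prod_eq_antidiagonal hs, ← tsum_div_const]
  refine tsum_congr fun n => ?_
  have hsum := sum_antidiagonal_add (fun j => 1 / (2 * (j : ℝ) + 1)) n
  rw [show h (n + 1) / ((n : ℝ) + 1) ^ 2 / 2 = 2 * h (n + 1) / (4 * ((n : ℝ) + 1) ^ 2) by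
      field_simp; norm_num,
    h, ← hsum, Finset.sum_div]
  refine Finset.sum_congr rfl fun x hx => ?_
  have hx' : (n : ℝ) = x.1 + x.2 := by exact_mod_cast (Finset.HasAntidiagonal.mem_antidiagonal.1 hx).symm
  simp only [tornheim]
  push_cast
  rw [hx']
  field_simp
  ring

lemma tsum_tornheim_even_odd :
    ∑' x : ℕ × ℕ, tornheim (2 * x.1 + 1, 2 * x.2)
      = (∑' k : ℕ, h (k + 1) / ((k : ℝ) + 1) ^ 2) / 4 := by
  have he : Function.Injective fun n : ℕ => 2 * n := mul_right_injective₀ two_ne_zero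
  have ho : Function.Injective fun n : ℕ => 2 * n + 1 := (add_left_injective 1).comp he
  have hs : Summable fun x : ℕ × ℕ => tornheim (2 * x.1 + 1, 2 * x.2) :=
    summable_tornheim.comp_injective (ho.prodMap he)
  rw [hs.tsum_prod, ← tsum_div_const]
  refine tsum_congr fun k => HasSum.tsum_eq ?_
  rw [div_div]
  refine ((hasSum_h (k + 1)).div_const (((k : ℝ) + 1) ^ 2 * 4)).congr_fun fun n => ?_
  simp only [tornheim]
  push_cast
  field_simp
  ring

lemma tsum_tornheim_odd_even :
    ∑' x : ℕ × ℕ, tornheim (2 * x.1, 2 * x.2 + 1)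
      = (∑' k : ℕ, h (k + 1) / ((k : ℝ) + 1) ^ 2) / 4 := by
  rw [← tsum_tornheim_even_odd, ← (Equiv.prodComm ℕ ℕ).tsum_eq]
  refine tsum_congr fun x => ?_
  simp only [tornheim, Equiv.prodComm_apply, Prod.fst_swap, Prod.snd_swap]
  ring

lemma tsum_h_div_sq : ∑' k : ℕ, h (k + 1) / ((k : ℝ) + 1) ^ 2 = 7 / 4 * zeta 3 := by
  have hpar := tsum_prod_parity summable_tornheim
  rw [tsum_tornheim_odd_odd, tsum_tornheim_even_even, tsum_tornheim_even_odd,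
    tsum_tornheim_odd_even, tsum_tornheim, tsum_H_div_sq] at hpar
  linarith

lemma tsum_prod_symmetrize {f g : ℕ × ℕ → ℝ} (hf : Summable f)
    (hfg : ∀ x, f x + f x.swap = g x) : 2 * ∑' x, f x = ∑' x, g x := by
  have hsw : ∑' x : ℕ × ℕ, f x.swap = ∑' x, f x := (Equiv.prodComm ℕ ℕ).tsum_eq f
  have hs : Summable fun x : ℕ × ℕ => f x.swap := (Equiv.prodComm ℕ ℕ).summable_iff.2 hf
  rw [two_mul]
  nth_rewrite 2 [← hsw]
  rw [← hf.tsum_add hs]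
  exact tsum_congr hfg

/-- The double sum of `h k * h n / (k² n (k + n))`, summed by rows and by symmetry. -/
lemma tsum_h_mul_row :
    2 * ∑' k : ℕ, h (k + 1) / ((k : ℝ) + 1) ^ 3
        * (2 * Real.log 2 * h (k + 1) + H (k + 1) * h (k + 1)
          - ∑ i ∈ Finset.range (k + 1), h (i + 1) / ((i : ℝ) + 1))
      = (∑' k : ℕ, h (k + 1) / ((k : ℝ) + 1) ^ 2) ^ 2 := by
  set a : ℕ → ℝ := fun k => h (k + 1) / ((k : ℝ) + 1) ^ 2 with ha
  have ha0 : ∀ k, 0 ≤ a k := fun k => div_nonneg (h_nonneg _) (by positivity)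
  have hprod : Summable fun x : ℕ × ℕ => a x.1 * a x.2 :=
    summable_h_div_sq.mul_of_nonneg summable_h_div_sq ha0 ha0
  set f : ℕ × ℕ → ℝ := fun x => a x.1 * a x.2 * (((x.2 : ℝ) + 1) / ((x.2 : ℝ) + x.1 + 2)) with hf
  have hfs : Summable f := by
    refine Summable.of_nonneg_of_le (fun x => ?_) (fun x => ?_) hprod
    · exact mul_nonneg (mul_nonneg (ha0 _) (ha0 _)) (by positivity)
    · refine mul_le_of_le_one_right (mul_nonneg (ha0 _) (ha0 _)) ?_
      rw [div_le_one (by positivity)]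
      linarith [(Nat.cast_nonneg x.1 : (0 : ℝ) ≤ x.1)]
  have hsym := tsum_prod_symmetrize (g := fun x => a x.1 * a x.2) hfs fun x => by
    simp only [hf, Prod.fst_swap, Prod.snd_swap]
    rw [add_comm (x.2 : ℝ) x.1]
    field_simp
    ring
  rw [sq, summable_h_div_sq.tsum_mul_tsum summable_h_div_sq hprod, ← hsym, hfs.tsum_prod]
  congr 1
  refine tsum_congr fun k => (HasSum.tsum_eq ?_).symm
  refine ((hasSum_h_mul_one_div_sub (k + 1)).mul_left
    (h (k + 1) / ((k : ℝ) + 1) ^ 3)).congr_fun fun n => ?_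
  simp only [hf, ha]
  push_cast
  rw [show (n : ℝ) + (k + 1) + 1 = n + k + 2 by ring]
  field_simp
  ring

theorem stmt10 :
    Summable (fun k : ℕ => h (k + 1) / ((k : ℝ) + 1) ^ 3
        * (∑ i ∈ Finset.range (k + 1), h (i + 1) / ((i : ℝ) + 1))) ∧
    Summable (fun k : ℕ => (h (k + 1)) ^ 2 / ((k : ℝ) + 1) ^ 3) ∧
    Summable (fun k : ℕ => H (k + 1) * (h (k + 1)) ^ 2 / ((k : ℝ) + 1) ^ 3) ∧
    (∑' k : ℕ, h (k + 1) / ((k : ℝ) + 1) ^ 3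
        * (∑ i ∈ Finset.range (k + 1), h (i + 1) / ((i : ℝ) + 1)))
      = -(49 / 32) * (zeta 3) ^ 2
        + 2 * Real.log 2 * (∑' k : ℕ, (h (k + 1)) ^ 2 / ((k : ℝ) + 1) ^ 3)
        + (∑' k : ℕ, H (k + 1) * (h (k + 1)) ^ 2 / ((k : ℝ) + 1) ^ 3) := by
  refine ⟨summable_h_mul_sum_div_cube, summable_h_sq_div_cube, summable_H_mul_h_sq_div_cube, ?_⟩
  have hrow := tsum_h_mul_row
  have hsplit : ∑' k : ℕ, h (k + 1) / ((k : ℝ) + 1) ^ 3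
        * (2 * Real.log 2 * h (k + 1) + H (k + 1) * h (k + 1)
          - ∑ i ∈ Finset.range (k + 1), h (i + 1) / ((i : ℝ) + 1))
      = 2 * Real.log 2 * (∑' k : ℕ, (h (k + 1)) ^ 2 / ((k : ℝ) + 1) ^ 3)
        + (∑' k : ℕ, H (k + 1) * (h (k + 1)) ^ 2 / ((k : ℝ) + 1) ^ 3)
        - ∑' k : ℕ, h (k + 1) / ((k : ℝ) + 1) ^ 3
          * (∑ i ∈ Finset.range (k + 1), h (i + 1) / ((i : ℝ) + 1)) := by
    have hlog := summable_h_sq_div_cube.mul_left (2 * Real.log 2)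
    rw [← tsum_mul_left, ← hlog.tsum_add summable_H_mul_h_sq_div_cube,
      ← (hlog.add summable_H_mul_h_sq_div_cube).tsum_sub summable_h_mul_sum_div_cube]
    exact tsum_congr fun k => by ring
  rw [hsplit, tsum_h_div_sq] at hrow
  linarith
end
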